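/- Fix N ≥ 2, ℏ > 0 and real numbers λ_1,…,λ_N. Let f : ℝ^{N−1} → ℂ be smooth, suppose there exist constants C > 0 and a > 0 such that |∂^α f(y)| ≤ C e^{a Σ_{i=1}^{N−1} |y_i|} for all y and all multi-indices α of order at most N, and suppose f is a joint eigenfunction of the (N−1)-particle open Toda chain: A_{N−1}(u) f = ( ∏_{k=1}^{N−1} (u − λ_k) ) f for all u ∈ ℂ. Then g(x) = ∫_{ℝ^{N−1}} Q_{λ_N}^{(N)}(x; y) f(y) dy is a smooth joint eigenfunction of the N-particle open Toda chain: A_N(u) g = ( ∏_{k=1}^{N} (u − λ_k) ) g for all u ∈ ℂ. -/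

import Mathlib

open MeasureTheory

noncomputable section

/-- The coordinate `x_n` (1-based), read as `0` when out of range. -/
def xc (M : ℕ) (x : Fin M → ℝ) (n : ℕ) : ℝ :=
  if h : 1 ≤ n ∧ n - 1 < M then x ⟨n - 1, h.2⟩ else 0

/-- The momentum operator `p_n = −iℏ ∂/∂x_n` (1-based), read as `0` when out of range. -/
def pOp (M : ℕ) (hbar : ℝ) (f : (Fin M → ℝ) → ℂ) (n : ℕ) (x : Fin M → ℝ) : ℂ :=
  if h : 1 ≤ n ∧ n - 1 < M then
    -Complex.I * (hbar : ℂ) * fderiv ℝ f x (Pi.single ⟨n - 1, h.2⟩ 1)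
  else 0

/-- The operators `A_n(u)` defined by `A_{-1}(u) = 0`, `A_0(u) = 1` and
`A_n(u) = (u − p_n) A_{n−1}(u) − e^{x_{n−1} − x_n} A_{n−2}(u)`; `A_N(u)` is the generating
function `Σ_{n=0}^{N} (−1)^n u^{N−n} H_n^{(N)}` of the open Toda chain Hamiltonians. -/
def Aop (M : ℕ) (hbar : ℝ) (u : ℂ) : ℕ → ((Fin M → ℝ) → ℂ) → (Fin M → ℝ) → ℂ
  | 0, f, x => f x
  | 1, f, x => u * f x - pOp M hbar f 1 x
  | (n + 2), f, x =>
      u * Aop M hbar u (n + 1) f x - pOp M hbar (Aop M hbar u (n + 1) f) (n + 2) x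
        - (Real.exp (xc M x (n + 1) - xc M x (n + 2)) : ℂ) * Aop M hbar u n f x

/-- The kernel
`Q^{(N)}_v(x; y) = exp( (i v/ℏ)(Σ_{i=1}^N x_i − Σ_{i=1}^{N−1} y_i)
  − (1/ℏ) Σ_{i=1}^{N−1} (e^{x_i − y_i} + e^{y_i − x_{i+1}}) )`. -/
def Qker (N : ℕ) (hbar : ℝ) (v : ℂ) (x : Fin N → ℝ) (y : Fin (N - 1) → ℝ) : ℂ :=
  Complex.exp
    (Complex.I * v / (hbar : ℂ) * ((∑ i : Fin N, (x i : ℂ)) - ∑ i : Fin (N - 1), (y i : ℂ))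
      - (1 / (hbar : ℂ)) * ∑ i : Fin (N - 1),
          ((Real.exp (x (Fin.castLE (Nat.sub_le N 1) i) - y i) : ℂ)
            + (Real.exp (y i - if h : i.val + 1 < N then x ⟨i.val + 1, h⟩ else 0) : ℂ)))

/-- Continuous functions of at most exponential growth. -/
def ExpBdd {M : ℕ} (w : (Fin M → ℝ) → ℂ) : Prop :=
  Continuous w ∧ ∃ C a : ℝ, 0 ≤ C ∧ ∀ y, ‖w y‖ ≤ C * Real.exp (a * ∑ i, |y i|)

namespace ExpBdd

variable {M : ℕ} {w z : (Fin M → ℝ) → ℂ}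

lemma add (hw : ExpBdd w) (hz : ExpBdd z) : ExpBdd (fun y => w y + z y) := by
  obtain ⟨hwc, C, a, hC, hwb⟩ := hw
  obtain ⟨hzc, D, b, hD, hzb⟩ := hz
  refine ⟨hwc.add hzc, C + D, max a b, add_nonneg hC hD, fun y => ?_⟩
  have hs : 0 ≤ ∑ i, |y i| := Finset.sum_nonneg fun i _ => abs_nonneg _
  calc ‖w y + z y‖ ≤ ‖w y‖ + ‖z y‖ := norm_add_le _ _
    _ ≤ C * Real.exp (a * ∑ i, |y i|) + D * Real.exp (b * ∑ i, |y i|) :=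
        add_le_add (hwb y) (hzb y)
    _ ≤ C * Real.exp (max a b * ∑ i, |y i|) + D * Real.exp (max a b * ∑ i, |y i|) := by
        gcongr
        · exact le_max_left _ _
        · exact le_max_right _ _
    _ = _ := by ring

lemma mul (hw : ExpBdd w) (hz : ExpBdd z) : ExpBdd (fun y => w y * z y) := by
  obtain ⟨hwc, C, a, hC, hwb⟩ := hw
  obtain ⟨hzc, D, b, hD, hzb⟩ := hz
  refine ⟨hwc.mul hzc, C * D, a + b, mul_nonneg hC hD, fun y => ?_⟩
  calc ‖w y * z y‖ = ‖w y‖ * ‖z y‖ := norm_mul _ _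
    _ ≤ (C * Real.exp (a * ∑ i, |y i|)) * (D * Real.exp (b * ∑ i, |y i|)) := by
        gcongr
        · exact hwb y
        · exact hzb y
    _ = _ := by rw [add_mul, Real.exp_add]; ring

lemma const (c : ℂ) : ExpBdd (fun _ : Fin M → ℝ => c) :=
  ⟨continuous_const, ‖c‖, 0, norm_nonneg _, fun y => by simp⟩

lemma sub (hw : ExpBdd w) (hz : ExpBdd z) : ExpBdd (fun y => w y - z y) := by
  simpa [sub_eq_add_neg] using hw.add ((const (-1)).mul hz)

lemma rexp (i : Fin M) (s c : ℝ) : ExpBdd (fun y => (Real.exp (s * y i + c) : ℂ)) := by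
  refine ⟨by fun_prop, Real.exp c, |s|, (Real.exp_pos _).le, fun y => ?_⟩
  rw [Complex.norm_real, Real.norm_eq_abs, Real.abs_exp, ← Real.exp_add]
  apply Real.exp_le_exp.2
  have h1 : |y i| ≤ ∑ i, |y i| :=
    Finset.single_le_sum (f := fun i => |y i|) (fun i _ => abs_nonneg _) (Finset.mem_univ i)
  have h2 : s * y i ≤ |s| * |y i| := by rw [← abs_mul]; exact le_abs_self _
  have h3 := mul_le_mul_of_nonneg_left h1 (abs_nonneg s)
  linarith

lemma sum {ι : Type*} (s : Finset ι) {w : ι → (Fin M → ℝ) → ℂ} (hw : ∀ i, ExpBdd (w i)) :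
    ExpBdd (fun y => ∑ i ∈ s, w i y) := by
  classical
  induction s using Finset.induction_on with
  | empty => simpa using const 0
  | insert i s hi ih =>
    simp_rw [Finset.sum_insert hi]
    exact (hw i).add ih

lemma rexp_sub_const (i : Fin M) (c : ℝ) : ExpBdd (fun y => (Real.exp (y i - c) : ℂ)) := by
  simpa [sub_eq_add_neg] using rexp i 1 (-c)

lemma rexp_const_sub (i : Fin M) (c : ℝ) : ExpBdd (fun y => (Real.exp (c - y i) : ℂ)) := by
  simpa [sub_eq_add_neg, add_comm] using rexp i (-1) c

end ExpBdd

lemma integrable_exp_neg_sq_mul_exp_abs {M : ℕ} {δ : ℝ} (hδ : 0 < δ) (a : ℝ) :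
    Integrable fun y : Fin M → ℝ =>
      Real.exp (-δ * ∑ i, y i ^ 2) * Real.exp (a * ∑ i, |y i|) := by
  have h1 : Integrable fun t : ℝ => Real.exp (-δ * t ^ 2 + a * |t|) := by
    refine Integrable.mono' (g := fun t => Real.exp (a ^ 2 / (2 * δ)) * Real.exp (-(δ / 2) * t ^ 2))
      ((integrable_exp_neg_mul_sq (half_pos hδ)).const_mul _)
      (by fun_prop) (Filter.Eventually.of_forall fun t => ?_)
    rw [Real.norm_eq_abs, Real.abs_exp, ← Real.exp_add]
    apply Real.exp_le_exp.2
    have h2 : 0 ≤ (δ * |t| - a) ^ 2 / (2 * δ) := by positivity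
    have h3 : (δ * |t| - a) ^ 2 / (2 * δ) = δ / 2 * t ^ 2 - a * |t| + a ^ 2 / (2 * δ) := by
      rw [← sq_abs t]; field_simp; ring
    linarith
  have h4 := Integrable.fintype_prod (ι := Fin M) (𝕜 := ℝ) (μ := fun _ => volume)
    (f := fun _ (t : ℝ) => Real.exp (-δ * t ^ 2 + a * |t|)) (fun _ => h1)
  have h5 : (fun y : Fin M → ℝ => Real.exp (-δ * ∑ i, y i ^ 2) * Real.exp (a * ∑ i, |y i|))
      = fun y => ∏ i, Real.exp (-δ * y i ^ 2 + a * |y i|) := by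
    funext y
    rw [← Real.exp_sum, ← Real.exp_add, Finset.sum_add_distrib, Finset.mul_sum, Finset.mul_sum]
  rw [h5]
  exact h4

lemma sq_le_exp_add_exp_neg (t : ℝ) : t ^ 2 / 2 ≤ Real.exp t + Real.exp (-t) := by
  rcases le_total 0 t with h | h
  · have := Real.quadratic_le_exp_of_nonneg h
    have := Real.exp_pos (-t)
    linarith
  · have := Real.quadratic_le_exp_of_nonneg (neg_nonneg.2 h)
    have := Real.exp_pos t
    nlinarith

/-- The kernel `Qker` for `N = M + 1`. -/
def bKer (M : ℕ) (hbar v : ℝ) (x : Fin (M + 1) → ℝ) (y : Fin M → ℝ) : ℂ :=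
  Complex.exp (Complex.I * v / hbar * ((∑ i, (x i : ℂ)) - ∑ i, (y i : ℂ))
    - (1 / (hbar : ℂ)) * ∑ i : Fin M,
      ((Real.exp (x i.castSucc - y i) : ℂ) + (Real.exp (y i - x i.succ) : ℂ)))

lemma Qker_eq_bKer (M : ℕ) (hbar v : ℝ) (x : Fin (M + 1) → ℝ) (y : Fin M → ℝ) :
    Qker (M + 1) hbar (v : ℂ) x y = bKer M hbar v x y := by
  unfold Qker bKer
  have h : ∀ i : Fin M, (if h : i.val + 1 < M + 1 then x ⟨i.val + 1, h⟩ else 0) = x i.succ :=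
    fun i => dif_pos (Nat.succ_lt_succ i.2)
  congr 2
  congr 1
  refine Finset.sum_congr rfl fun i _ => ?_
  congr 3
  congr 1
  exact h i

lemma continuous_bKer (M : ℕ) (hbar v : ℝ) (x : Fin (M + 1) → ℝ) :
    Continuous (bKer M hbar v x) := by
  unfold bKer
  fun_prop

lemma norm_bKer (M : ℕ) (hbar v : ℝ) (x : Fin (M + 1) → ℝ) (y : Fin M → ℝ) :
    ‖bKer M hbar v x y‖ = Real.exp (-(1 / hbar) *
      ∑ i : Fin M, (Real.exp (x i.castSucc - y i) + Real.exp (y i - x i.succ))) := by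
  unfold bKer
  have : (Complex.I * v / hbar * ((∑ i, (x i : ℂ)) - ∑ i, (y i : ℂ))
    - (1 / (hbar : ℂ)) * ∑ i : Fin M,
      ((Real.exp (x i.castSucc - y i) : ℂ) + (Real.exp (y i - x i.succ) : ℂ)))
      = ((-(1 / hbar) *
      ∑ i : Fin M, (Real.exp (x i.castSucc - y i) + Real.exp (y i - x i.succ)) : ℝ) : ℂ) +
        ((v / hbar * ((∑ i, x i) - ∑ i, y i) : ℝ) : ℂ) * Complex.I := by
    push_cast
    ring
  rw [Complex.norm_exp, this, Complex.add_re, Complex.ofReal_re, Complex.re_ofReal_mul,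
    Complex.I_re, mul_zero, add_zero]

lemma norm_bKer_le {M : ℕ} {hbar : ℝ} (hh : 0 < hbar) (v R : ℝ) {x : Fin (M + 1) → ℝ}
    (hx : ∀ i, |x i| ≤ R) (y : Fin M → ℝ) :
    ‖bKer M hbar v x y‖ ≤ Real.exp (-(Real.exp (-R) / (2 * hbar)) * ∑ i, y i ^ 2) := by
  rw [norm_bKer]
  apply Real.exp_le_exp.2
  have h : Real.exp (-R) / 2 * ∑ i, y i ^ 2 ≤
      ∑ i : Fin M, (Real.exp (x i.castSucc - y i) + Real.exp (y i - x i.succ)) := by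
    rw [Finset.mul_sum]
    refine Finset.sum_le_sum fun i _ => ?_
    have h1 : Real.exp (-R) * Real.exp (- y i) ≤ Real.exp (x i.castSucc - y i) := by
      rw [← Real.exp_add]
      apply Real.exp_le_exp.2
      linarith [neg_le_of_abs_le (hx i.castSucc)]
    have h2 : Real.exp (-R) * Real.exp (y i) ≤ Real.exp (y i - x i.succ) := by
      rw [← Real.exp_add]
      apply Real.exp_le_exp.2
      linarith [le_of_abs_le (hx i.succ)]
    have h3 := mul_le_mul_of_nonneg_left (sq_le_exp_add_exp_neg (y i)) (Real.exp_pos (-R)).le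
    linarith
  have h5 := mul_le_mul_of_nonneg_left h (one_div_pos.2 hh).le
  have h6 : Real.exp (-R) / (2 * hbar) * ∑ i, y i ^ 2
      = 1 / hbar * (Real.exp (-R) / 2 * ∑ i, y i ^ 2) := by field_simp
  linarith

lemma integrable_bKer_mul {M : ℕ} {hbar : ℝ} (hh : 0 < hbar) (v : ℝ) (x : Fin (M + 1) → ℝ)
    {w : (Fin M → ℝ) → ℂ} (hw : ExpBdd w) :
    Integrable fun y => bKer M hbar v x y * w y := by
  obtain ⟨hc, C, a, hC, hb⟩ := hw
  have hx : ∀ i, |x i| ≤ ‖x‖ := fun i => norm_le_pi_norm x i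
  refine Integrable.mono' ((integrable_exp_neg_sq_mul_exp_abs
    (δ := Real.exp (-‖x‖) / (2 * hbar)) (by positivity) a).const_mul C)
    ((continuous_bKer M hbar v x).mul hc).aestronglyMeasurable
    (Filter.Eventually.of_forall fun y => ?_)
  rw [norm_mul]
  calc _ ≤ Real.exp (-(Real.exp (-‖x‖) / (2 * hbar)) * ∑ i, y i ^ 2) *
        (C * Real.exp (a * ∑ i, |y i|)) := by
        gcongr
        · exact norm_bKer_le hh v _ hx y
        · exact hb y
    _ = _ := by ring

/-- The coordinate functional `x ↦ x_j` with complex values. -/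
def coordC {n : ℕ} (j : Fin n) : (Fin n → ℝ) →L[ℝ] ℂ :=
  Complex.ofRealCLM.comp (ContinuousLinearMap.proj j)

/-- The logarithmic derivative of `bKer` in the variable `x`. -/
def bKerLog (M : ℕ) (hbar v : ℝ) (x : Fin (M + 1) → ℝ) (y : Fin M → ℝ) :
    (Fin (M + 1) → ℝ) →L[ℝ] ℂ :=
  (Complex.I * v / hbar) • ∑ j, coordC j - (1 / (hbar : ℂ)) • ∑ i : Fin M,
    ((Real.exp (x i.castSucc - y i) : ℂ) • coordC i.castSucc
      - (Real.exp (y i - x i.succ) : ℂ) • coordC i.succ)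

lemma hasFDerivAt_bKer (M : ℕ) (hbar v : ℝ) (x : Fin (M + 1) → ℝ) (y : Fin M → ℝ) :
    HasFDerivAt (fun x => bKer M hbar v x y) (bKer M hbar v x y • bKerLog M hbar v x y) x := by
  have hc : ∀ j : Fin (M + 1), HasFDerivAt (fun x : Fin (M + 1) → ℝ => (x j : ℂ)) (coordC j) x :=
    fun j => (coordC j).hasFDerivAt
  have he : ∀ (x : Fin (M + 1) → ℝ) (i : Fin M),
      ((Real.exp (x i.castSucc - y i) : ℂ) + (Real.exp (y i - x i.succ) : ℂ)) =
      Complex.exp ((x i.castSucc : ℂ) - y i) + Complex.exp ((y i : ℂ) - x i.succ) := by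
    intro x i; push_cast; rfl
  unfold bKer bKerLog
  refine HasFDerivAt.cexp ?_
  refine HasFDerivAt.sub (((HasFDerivAt.fun_sum fun j _ => hc j).sub_const _).const_mul _) ?_
  refine HasFDerivAt.const_mul (HasFDerivAt.fun_sum fun i _ => ?_) _
  simp_rw [he]
  have h1 := ((hc i.castSucc).sub_const (y i : ℂ)).cexp
  have h2 := ((hc i.succ).const_sub (y i : ℂ)).cexp
  convert! h1.add h2 using 1
  ext z
  simp
  ring

lemma bKerLog_apply (M : ℕ) (hbar v : ℝ) (x z : Fin (M + 1) → ℝ) (y : Fin M → ℝ) :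
    bKerLog M hbar v x y z = (Complex.I * v / hbar) * ∑ j, (z j : ℂ)
      - (1 / (hbar : ℂ)) * ∑ i : Fin M,
      ((Real.exp (x i.castSucc - y i) : ℂ) * z i.castSucc
        - (Real.exp (y i - x i.succ) : ℂ) * z i.succ) := by
  simp [bKerLog, coordC]

lemma continuous_bKerLog (M : ℕ) (hbar v : ℝ) (x : Fin (M + 1) → ℝ) :
    Continuous (bKerLog M hbar v x) := by
  unfold bKerLog
  fun_prop

lemma norm_bKerLog_le (M : ℕ) (hbar v R : ℝ) :
    ∃ D : ℝ, 0 ≤ D ∧ ∀ x : Fin (M + 1) → ℝ, (∀ i, |x i| ≤ R) → ∀ y : Fin M → ℝ,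
      ‖bKerLog M hbar v x y‖ ≤ D * Real.exp (∑ i, |y i|) := by
  let D₁ := ‖(Complex.I * v / hbar) • ∑ j : Fin (M + 1), coordC j‖
  let D₂ := ‖(1 / (hbar : ℂ))‖ * ∑ i : Fin M,
    (Real.exp R * ‖coordC i.castSucc‖ + Real.exp R * ‖coordC i.succ‖)
  have hD₂ : 0 ≤ D₂ := by positivity
  refine ⟨D₁ + D₂, by positivity, fun x hx y => ?_⟩
  have hs : 0 ≤ ∑ i, |y i| := Finset.sum_nonneg fun i _ => abs_nonneg _
  have hle : ∀ i, |y i| ≤ ∑ i, |y i| := fun i =>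
    Finset.single_le_sum (f := fun i => |y i|) (fun i _ => abs_nonneg _) (Finset.mem_univ i)
  have h2 : ‖(1 / (hbar : ℂ)) • ∑ i : Fin M,
      ((Real.exp (x i.castSucc - y i) : ℂ) • (coordC i.castSucc : (Fin (M + 1) → ℝ) →L[ℝ] ℂ)
      - (Real.exp (y i - x i.succ) : ℂ) • coordC i.succ)‖ ≤ D₂ * Real.exp (∑ i, |y i|) := by
    rw [norm_smul, mul_assoc, Finset.sum_mul]
    refine mul_le_mul_of_nonneg_left (norm_sum_le_of_le _ fun i _ => ?_) (norm_nonneg _)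
    refine (norm_sub_le _ _).trans ?_
    rw [norm_smul, norm_smul, Complex.norm_real, Complex.norm_real, Real.norm_eq_abs,
      Real.norm_eq_abs, Real.abs_exp, Real.abs_exp, add_mul, mul_right_comm, ← Real.exp_add,
      mul_right_comm, ← Real.exp_add]
    gcongr
    · linarith [le_of_abs_le (hx i.castSucc), neg_abs_le (y i), hle i]
    · linarith [neg_le_of_abs_le (hx i.succ), le_abs_self (y i), hle i]
  calc ‖bKerLog M hbar v x y‖ ≤ D₁ + D₂ * Real.exp (∑ i, |y i|) :=
        (norm_sub_le _ _).trans (add_le_add le_rfl h2)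
    _ ≤ D₁ * Real.exp (∑ i, |y i|) + D₂ * Real.exp (∑ i, |y i|) := by
        gcongr
        exact le_mul_of_one_le_right (norm_nonneg _) (Real.one_le_exp hs)
    _ = _ := by ring

/-- The integral transform with kernel `bKer`. -/
def bTrans (M : ℕ) (hbar v : ℝ) (w : (Fin M → ℝ) → ℂ) (x : Fin (M + 1) → ℝ) : ℂ :=
  ∫ y : Fin M → ℝ, bKer M hbar v x y * w y

lemma hasFDerivAt_bTrans {M : ℕ} {hbar : ℝ} (hh : 0 < hbar) (v : ℝ) {w : (Fin M → ℝ) → ℂ}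
    (hw : ExpBdd w) (x : Fin (M + 1) → ℝ) :
    HasFDerivAt (bTrans M hbar v w) (∫ y, (bKer M hbar v x y * w y) • bKerLog M hbar v x y) x ∧
    Integrable (fun y => (bKer M hbar v x y * w y) • bKerLog M hbar v x y) := by
  have hw' := hw
  obtain ⟨hc, C, a, hC, hb⟩ := hw'
  obtain ⟨D, hD, hDb⟩ := norm_bKerLog_le M hbar v (‖x‖ + 1)
  let bound : (Fin M → ℝ) → ℝ := fun y => (C * D) *
    (Real.exp (-(Real.exp (-(‖x‖ + 1)) / (2 * hbar)) * ∑ i, y i ^ 2) *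
      Real.exp ((a + 1) * ∑ i, |y i|))
  have hbi : Integrable bound :=
    (integrable_exp_neg_sq_mul_exp_abs (by positivity) (a + 1)).const_mul (C * D)
  have hbd : ∀ y, ∀ x' ∈ Metric.ball x 1,
      ‖(bKer M hbar v x' y * w y) • bKerLog M hbar v x' y‖ ≤ bound y := by
    intro y x' hx'
    have hx : ∀ i, |x' i| ≤ ‖x‖ + 1 := fun i => by
      have h1 : |x' i| ≤ ‖x'‖ := norm_le_pi_norm x' i
      have h2 : ‖x'‖ ≤ ‖x‖ + ‖x' - x‖ := norm_le_norm_add_norm_sub' _ _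
      have h3 : ‖x' - x‖ < 1 := by rwa [← dist_eq_norm]
      linarith
    rw [norm_smul, norm_mul]
    calc _ ≤ Real.exp (-(Real.exp (-(‖x‖ + 1)) / (2 * hbar)) * ∑ i, y i ^ 2) *
        (C * Real.exp (a * ∑ i, |y i|)) * (D * Real.exp (∑ i, |y i|)) := by
          gcongr
          · exact norm_bKer_le hh v _ hx y
          · exact hb y
          · exact hDb x' hx y
      _ = _ := by
          simp only [bound]
          rw [add_mul, one_mul, Real.exp_add]
          ring
  have hm : AEStronglyMeasurable (fun y => (bKer M hbar v x y * w y) • bKerLog M hbar v x y)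
      volume :=
    (((continuous_bKer M hbar v x).mul hc).smul (continuous_bKerLog M hbar v x)).aestronglyMeasurable
  refine ⟨hasFDerivAt_integral_of_dominated_of_fderiv_le (bound := bound)
    (F' := fun x y => (bKer M hbar v x y * w y) • bKerLog M hbar v x y)
    (Metric.ball_mem_nhds x one_pos)
    (Filter.Eventually.of_forall fun x' =>
      ((continuous_bKer M hbar v x').mul hc).aestronglyMeasurable)
    (integrable_bKer_mul hh v x hw) hm (Filter.Eventually.of_forall hbd) hbi
    (Filter.Eventually.of_forall fun y x' _ => ?_),
    hbi.mono' hm (Filter.Eventually.of_forall fun y => hbd y x (Metric.mem_ball_self one_pos))⟩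
  convert! (hasFDerivAt_bKer M hbar v x' y).mul_const (w y) using 1
  rw [smul_smul, mul_comm]

section transform

variable {M : ℕ} {hbar : ℝ} {w z : (Fin M → ℝ) → ℂ}

lemma bTrans_sub (hh : 0 < hbar) (v : ℝ) (hw : ExpBdd w) (hz : ExpBdd z) (x : Fin (M + 1) → ℝ) :
    bTrans M hbar v (fun y => w y - z y) x = bTrans M hbar v w x - bTrans M hbar v z x := by
  unfold bTrans
  rw [← integral_sub (integrable_bKer_mul hh v x hw) (integrable_bKer_mul hh v x hz)]
  simp_rw [mul_sub]

lemma bTrans_const_mul (v : ℝ) (c : ℂ) (w : (Fin M → ℝ) → ℂ) (x : Fin (M + 1) → ℝ) :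
    bTrans M hbar v (fun y => c * w y) x = c * bTrans M hbar v w x := by
  unfold bTrans
  rw [← integral_const_mul]
  simp_rw [mul_left_comm]

lemma bTrans_sum (hh : 0 < hbar) (v : ℝ) {ι : Type*} (s : Finset ι) {w : ι → (Fin M → ℝ) → ℂ}
    (hw : ∀ i, ExpBdd (w i)) (x : Fin (M + 1) → ℝ) :
    bTrans M hbar v (fun y => ∑ i ∈ s, w i y) x = ∑ i ∈ s, bTrans M hbar v (w i) x := by
  unfold bTrans
  rw [← integral_finsetSum _ fun i _ => integrable_bKer_mul hh v x (hw i)]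
  simp_rw [Finset.mul_sum]

lemma fderiv_bTrans_apply (hh : 0 < hbar) (v : ℝ) (hw : ExpBdd w) (x e : Fin (M + 1) → ℝ) :
    fderiv ℝ (bTrans M hbar v w) x e = bTrans M hbar v (fun y => bKerLog M hbar v x y e * w y) x := by
  obtain ⟨h1, h2⟩ := hasFDerivAt_bTrans hh v hw x
  rw [h1.fderiv, ContinuousLinearMap.integral_apply h2]
  unfold bTrans
  refine integral_congr_ae (Filter.Eventually.of_forall fun y => ?_)
  simp only [smul_apply, smul_eq_mul]
  ring

lemma contDiff_nat_bTrans (hh : 0 < hbar) (v : ℝ) (n : ℕ) :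
    ∀ {w : (Fin M → ℝ) → ℂ}, ExpBdd w → ContDiff ℝ n (bTrans M hbar v w) := by
  induction n with
  | zero =>
    intro w hw
    exact contDiff_zero.2 (continuous_iff_continuousAt.2 fun x =>
      (hasFDerivAt_bTrans hh v hw x).1.continuousAt)
  | succ n ih =>
    intro w hw
    push_cast
    rw [contDiff_succ_iff_fderiv_apply]
    refine ⟨fun x => (hasFDerivAt_bTrans hh v hw x).1.differentiableAt, by simp, fun e => ?_⟩
    have hm : ∀ i : Fin M, ExpBdd fun y => (Real.exp (0 - y i) : ℂ) * w y := fun i =>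
      (ExpBdd.rexp_const_sub i 0).mul hw
    have hp : ∀ i : Fin M, ExpBdd fun y => (Real.exp (y i - 0) : ℂ) * w y := fun i =>
      (ExpBdd.rexp_sub_const i 0).mul hw
    have key : (fun x => fderiv ℝ (bTrans M hbar v w) x e) = fun x =>
        (Complex.I * v / hbar * ∑ j, (e j : ℂ)) * bTrans M hbar v w x - (1 / (hbar : ℂ)) *
        ∑ i : Fin M, (((Real.exp (x i.castSucc) : ℂ) * e i.castSucc) *
            bTrans M hbar v (fun y => (Real.exp (0 - y i) : ℂ) * w y) x
          - ((Real.exp (-x i.succ) : ℂ) * e i.succ) *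
            bTrans M hbar v (fun y => (Real.exp (y i - 0) : ℂ) * w y) x) := by
      funext x
      rw [fderiv_bTrans_apply hh v hw]
      simp_rw [← bTrans_const_mul]
      have : ∀ i : Fin M, ExpBdd fun y => ((Real.exp (x i.castSucc) : ℂ) * e i.castSucc) *
          ((Real.exp (0 - y i) : ℂ) * w y) := fun i => (ExpBdd.const _).mul (hm i)
      have h' : ∀ i : Fin M, ExpBdd fun y => ((Real.exp (-x i.succ) : ℂ) * e i.succ) *
          ((Real.exp (y i - 0) : ℂ) * w y) := fun i => (ExpBdd.const _).mul (hp i)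
      simp_rw [fun i => (bTrans_sub hh v (this i) (h' i) x).symm]
      rw [← bTrans_sum hh v _ fun i => (this i).sub (h' i), ← bTrans_const_mul,
        ← bTrans_sub hh v ((ExpBdd.const _).mul hw)
          ((ExpBdd.const _).mul (ExpBdd.sum _ fun i => (this i).sub (h' i)))]
      congr 1
      funext y
      rw [bKerLog_apply, sub_mul, mul_assoc (1 / (hbar : ℂ)), Finset.sum_mul]
      congr 2
      refine Finset.sum_congr rfl fun i _ => ?_
      rw [sub_eq_add_neg (x i.castSucc), sub_eq_add_neg (y i), Real.exp_add, Real.exp_add, zero_sub,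
        sub_zero]
      push_cast
      ring
    rw [key]
    have hexp : ∀ i : Fin (M + 1), ∀ s : ℝ,
        ContDiff ℝ n fun x : Fin (M + 1) → ℝ => (Real.exp (s * x i) : ℂ) := fun i s =>
      Complex.ofRealCLM.contDiff.comp
        (show ContDiff ℝ n fun x : Fin (M + 1) → ℝ => Real.exp (s * x i) by fun_prop)
    refine (contDiff_const.mul (ih hw)).sub (contDiff_const.mul (ContDiff.sum fun i _ => ?_))
    have h1 := hexp i.castSucc 1
    have h2 := hexp i.succ (-1)
    simp only [one_mul, neg_mul] at h1 h2
    exact ((h1.mul contDiff_const).mul (ih (hm i))).sub ((h2.mul contDiff_const).mul (ih (hp i)))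

lemma contDiff_bTrans (hh : 0 < hbar) (v : ℝ) (hw : ExpBdd w) :
    ContDiff ℝ (⊤ : ℕ∞) (bTrans M hbar v w) :=
  contDiff_infty.2 fun n => contDiff_nat_bTrans hh v n hw

end transform

/-- The exponential `e^{x_n - y_n}` (1-based), read as `0` when out of range. -/
def expXY (M : ℕ) (x : Fin (M + 1) → ℝ) (y : Fin M → ℝ) (n : ℕ) : ℂ :=
  if 1 ≤ n ∧ n ≤ M then (Real.exp (xc (M + 1) x n - xc M y n) : ℂ) else 0

/-- The exponential `e^{y_n - x_{n+1}}` (1-based), read as `0` when out of range. -/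
def expYX (M : ℕ) (x : Fin (M + 1) → ℝ) (y : Fin M → ℝ) (n : ℕ) : ℂ :=
  if 1 ≤ n ∧ n ≤ M then (Real.exp (xc M y n - xc (M + 1) x (n + 1)) : ℂ) else 0

/-- The symbol of `A_n(u)` in the variables `x` acting on the kernel, as a function of
`α_n = e^{x_n - y_n}` and `β_n = e^{y_n - x_{n+1}}`. -/
def symX (u v : ℂ) (α β : ℕ → ℂ) : ℕ → ℂ
  | 0 => 1
  | 1 => u - (v + Complex.I * α 1 - Complex.I * β 0)
  | (n + 2) => (u - (v + Complex.I * α (n + 2) - Complex.I * β (n + 1))) * symX u v α β (n + 1)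
      - α (n + 1) * β (n + 1) * symX u v α β n

/-- The symbol of the transpose of `A_n(u)` in the variables `y` acting on the kernel, as a
function of `α_n = e^{x_n - y_n}` and `β_n = e^{y_n - x_{n+1}}`. -/
def symY (u v : ℂ) (α β : ℕ → ℂ) : ℕ → ℂ
  | 0 => 1
  | 1 => u - (v + Complex.I * α 1 - Complex.I * β 1)
  | (n + 2) => (u - (v + Complex.I * α (n + 2) - Complex.I * β (n + 2))) * symY u v α β (n + 1)
      - β (n + 1) * α (n + 2) * symY u v α β n

lemma symX_succ (u v : ℂ) {α β : ℕ → ℂ} (hβ : β 0 = 0) (n : ℕ) :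
    symX u v α β (n + 1) = symY u v α β (n + 1) - Complex.I * β (n + 1) * symY u v α β n := by
  have hI := Complex.I_mul_I
  induction n using Nat.twoStepInduction with
  | zero => simp only [symX, symY, hβ]; ring
  | one =>
    simp only [symX, symY, hβ]
    linear_combination (α 2 * β 1 - β 1 * α 1) * hI
  | more n h1 h2 =>
    rw [symX, h2, h1]
    simp only [symY]
    linear_combination
      (α (n + 3) * β (n + 2) - β (n + 2) * α (n + 2)) * symY u v α β (n + 1) * hI

lemma symX_congr (u v : ℂ) {α β α' β' : ℕ → ℂ} (n : ℕ) (hα : ∀ k ≤ n, α k = α' k)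
    (hβ : ∀ k < n, β k = β' k) : symX u v α β n = symX u v α' β' n := by
  induction n using Nat.twoStepInduction with
  | zero => rfl
  | one => simp only [symX, hα 1 le_rfl, hβ 0 one_pos]
  | more n h1 h2 =>
    rw [symX, symX, h1 (fun k hk => hα k (by omega)) (fun k hk => hβ k (by omega)),
      h2 (fun k hk => hα k (by omega)) (fun k hk => hβ k (by omega)), hα (n + 2) le_rfl,
      hα (n + 1) (by omega), hβ (n + 1) (by omega)]

section symbols

variable (M : ℕ) (x : Fin (M + 1) → ℝ)

lemma xc_succ {n m : ℕ} (h : n < m) (x : Fin m → ℝ) : xc m x (n + 1) = x ⟨n, h⟩ := by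
  simp [xc, h]

lemma expBdd_expXY (n : ℕ) : ExpBdd fun y => expXY M x y n := by
  unfold expXY
  split_ifs with h
  · obtain ⟨k, rfl⟩ := Nat.exists_eq_add_of_le' h.1
    simp_rw [xc_succ (show k < M by omega)]
    exact ExpBdd.rexp_const_sub _ _
  · exact ExpBdd.const 0

lemma expBdd_expYX (n : ℕ) : ExpBdd fun y => expYX M x y n := by
  unfold expYX
  split_ifs with h
  · obtain ⟨k, rfl⟩ := Nat.exists_eq_add_of_le' h.1
    simp_rw [xc_succ (show k < M by omega)]
    exact ExpBdd.rexp_sub_const _ _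
  · exact ExpBdd.const 0

lemma expBdd_momentum (u v : ℂ) (n k : ℕ) : ExpBdd fun y =>
    u - (v + Complex.I * expXY M x y n - Complex.I * expYX M x y k) :=
  (ExpBdd.const u).sub (((ExpBdd.const v).add ((ExpBdd.const _).mul (expBdd_expXY M x n))).sub
    ((ExpBdd.const _).mul (expBdd_expYX M x k)))

lemma expBdd_symX (u v : ℂ) (n : ℕ) :
    ExpBdd fun y => symX u v (expXY M x y) (expYX M x y) n := by
  induction n using Nat.twoStepInduction with
  | zero => exact ExpBdd.const 1
  | one => exact expBdd_momentum M x u v 1 0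
  | more n h1 h2 =>
    exact ((expBdd_momentum M x u v _ _).mul h2).sub
      (((expBdd_expXY M x _).mul (expBdd_expYX M x _)).mul h1)

lemma expBdd_symY (u v : ℂ) (n : ℕ) :
    ExpBdd fun y => symY u v (expXY M x y) (expYX M x y) n := by
  induction n using Nat.twoStepInduction with
  | zero => exact ExpBdd.const 1
  | one => exact expBdd_momentum M x u v 1 1
  | more n h1 h2 =>
    exact ((expBdd_momentum M x u v _ _).mul h2).sub
      (((expBdd_expYX M x _).mul (expBdd_expXY M x _)).mul h1)

end symbols

lemma sum_castSucc_single {M n : ℕ} (h : n < M + 1) (g : Fin M → ℂ) :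
    ∑ i : Fin M, g i * ((Pi.single (⟨n, h⟩ : Fin (M + 1)) (1 : ℝ) : Fin (M + 1) → ℝ) i.castSucc : ℂ)
      = if hn : n < M then g ⟨n, hn⟩ else 0 := by
  split_ifs with hn
  · rw [Finset.sum_eq_single ⟨n, hn⟩]
    · rw [show (⟨n, hn⟩ : Fin M).castSucc = ⟨n, h⟩ from rfl]
      simp
    · intro i _ hi
      rw [Pi.single_eq_of_ne]
      · simp
      · exact fun hc => hi (Fin.ext (by simpa using congrArg Fin.val hc))
    · simp
  · refine Finset.sum_eq_zero fun i _ => ?_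
    rw [Pi.single_eq_of_ne]
    · simp
    · intro hc
      have : i.val = n := congrArg Fin.val hc
      have := i.2
      omega

lemma sum_succ_single {M n : ℕ} (h : n < M + 1) (g : Fin M → ℂ) :
    ∑ i : Fin M, g i * ((Pi.single (⟨n, h⟩ : Fin (M + 1)) (1 : ℝ) : Fin (M + 1) → ℝ) i.succ : ℂ)
      = if hn : 1 ≤ n then g ⟨n - 1, by omega⟩ else 0 := by
  split_ifs with hn
  · rw [Finset.sum_eq_single ⟨n - 1, by omega⟩]
    · rw [show (⟨n - 1, by omega⟩ : Fin M).succ = ⟨n, h⟩ from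
        Fin.ext (Nat.sub_add_cancel hn)]
      simp
    · intro i _ hi
      rw [Pi.single_eq_of_ne]
      · simp
      · intro hc
        have : i.val + 1 = n := congrArg Fin.val hc
        exact hi (Fin.ext (by simp; omega))
    · simp
  · refine Finset.sum_eq_zero fun i _ => ?_
    rw [Pi.single_eq_of_ne]
    · simp
    · intro hc
      have : i.val + 1 = n := congrArg Fin.val hc
      omega

lemma momentum_bKerLog {M : ℕ} {hbar : ℝ} (hh : 0 < hbar) (v : ℝ) (x : Fin (M + 1) → ℝ)
    (y : Fin M → ℝ) {n : ℕ} (h : n < M + 1) :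
    -Complex.I * hbar * bKerLog M hbar v x y (Pi.single ⟨n, h⟩ 1)
      = v + Complex.I * expXY M x y (n + 1) - Complex.I * expYX M x y n := by
  have hI := Complex.I_mul_I
  have hne : (hbar : ℂ) ≠ 0 := by exact_mod_cast hh.ne'
  have h1 : ∑ j, ((Pi.single (⟨n, h⟩ : Fin (M + 1)) (1 : ℝ) : Fin (M + 1) → ℝ) j : ℂ) = 1 := by
    rw [← Complex.ofReal_sum]
    simp
  have hα : expXY M x y (n + 1)
      = if hn : n < M then (Real.exp (x (⟨n, hn⟩ : Fin M).castSucc - y ⟨n, hn⟩) : ℂ) else 0 := by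
    unfold expXY
    by_cases hn : n < M
    · rw [if_pos ⟨by omega, hn⟩, dif_pos hn, xc_succ h, xc_succ hn]
      rfl
    · rw [if_neg (by omega), dif_neg hn]
  have hβ : expYX M x y n = if hn : 1 ≤ n then
      (Real.exp (y ⟨n - 1, by omega⟩ - x (⟨n - 1, by omega⟩ : Fin M).succ) : ℂ) else 0 := by
    unfold expYX
    by_cases hn : 1 ≤ n
    · obtain ⟨k, rfl⟩ := Nat.exists_eq_add_of_le' hn
      rw [if_pos ⟨by omega, by omega⟩, dif_pos hn, xc_succ h, xc_succ (by omega)]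
      rfl
    · rw [if_neg (by omega), dif_neg hn]
  rw [bKerLog_apply, h1, Finset.sum_sub_distrib,
    sum_castSucc_single h fun i => (Real.exp (x i.castSucc - y i) : ℂ),
    sum_succ_single h fun i => (Real.exp (y i - x i.succ) : ℂ), ← hα, ← hβ]
  field_simp
  linear_combination (-(v : ℂ)) * hI

lemma fderiv_apply_congr_of_line {E : Type*} [NormedAddCommGroup E] [NormedSpace ℝ E]
    {F G : E → ℂ} {x e : E} (hF : DifferentiableAt ℝ F x) (hG : DifferentiableAt ℝ G x)
    (h : ∀ t : ℝ, F (x + t • e) = G (x + t • e)) : fderiv ℝ F x e = fderiv ℝ G x e := by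
  rw [← hF.lineDeriv_eq_fderiv, ← hG.lineDeriv_eq_fderiv]
  unfold lineDeriv
  simp_rw [h]

section smoothness

variable {M : ℕ}

lemma contDiff_xc (n : ℕ) : ContDiff ℝ (⊤ : ℕ∞) fun x : Fin M → ℝ => xc M x n := by
  unfold xc
  split_ifs with h
  · fun_prop
  · exact contDiff_const

lemma ContDiff.pOp {f : (Fin M → ℝ) → ℂ} (hf : ContDiff ℝ (⊤ : ℕ∞) f) (hbar : ℝ) (n : ℕ) :
    ContDiff ℝ (⊤ : ℕ∞) (pOp M hbar f n) := by
  unfold _root_.pOp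
  split_ifs with h
  · exact contDiff_const.mul ((contDiff_infty_iff_fderiv.1 hf).2.clm_apply contDiff_const)
  · exact contDiff_const

lemma ContDiff.Aop {f : (Fin M → ℝ) → ℂ} (hf : ContDiff ℝ (⊤ : ℕ∞) f) (hbar : ℝ) (u : ℂ)
    (n : ℕ) : ContDiff ℝ (⊤ : ℕ∞) (Aop M hbar u n f) := by
  induction n using Nat.twoStepInduction with
  | zero => exact hf
  | one => exact (contDiff_const.mul hf).sub (hf.pOp hbar 1)
  | more n h1 h2 =>
    refine ((contDiff_const.mul h2).sub (h2.pOp hbar (n + 2))).sub (ContDiff.mul ?_ h1)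
    exact Complex.ofRealCLM.contDiff.comp
      (Real.contDiff_exp.comp ((contDiff_xc (n + 1)).sub (contDiff_xc (n + 2))))

end smoothness

lemma xc_add_smul_single {m n k : ℕ} (h : n < m) (x : Fin m → ℝ) (t : ℝ) (hk : k ≠ n + 1) :
    xc m (x + t • Pi.single ⟨n, h⟩ 1) k = xc m x k := by
  unfold xc
  split_ifs with h'
  · rw [Pi.add_apply, Pi.smul_apply, Pi.single_eq_of_ne, smul_zero, add_zero]
    intro hc
    have : k - 1 = n := congrArg Fin.val hc
    omega
  · rfl

section kernelSide

variable {M : ℕ} {hbar : ℝ}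

lemma pOp_bTrans (hh : 0 < hbar) (v : ℝ) {w : (Fin M → ℝ) → ℂ} (hw : ExpBdd w)
    (x : Fin (M + 1) → ℝ) {n : ℕ} (h : n < M + 1) :
    pOp (M + 1) hbar (bTrans M hbar v w) (n + 1) x
      = bTrans M hbar v (fun y =>
        (v + Complex.I * expXY M x y (n + 1) - Complex.I * expYX M x y n) * w y) x := by
  unfold pOp
  rw [dif_pos ⟨by omega, by simpa using h⟩, fderiv_bTrans_apply hh v hw, ← bTrans_const_mul]
  congr 1
  funext y
  rw [← momentum_bKerLog hh v x y h]
  exact (mul_assoc _ _ _).symm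

lemma pOp_congr_of_line {m : ℕ} {F G : (Fin m → ℝ) → ℂ} {x : Fin m → ℝ} {n : ℕ} (h : n < m)
    (hF : DifferentiableAt ℝ F x) (hG : DifferentiableAt ℝ G x)
    (hFG : ∀ t : ℝ, F (x + t • Pi.single ⟨n, h⟩ 1) = G (x + t • Pi.single ⟨n, h⟩ 1)) :
    pOp m hbar F (n + 1) x = pOp m hbar G (n + 1) x := by
  unfold pOp
  rw [dif_pos ⟨by omega, by simpa using h⟩, dif_pos ⟨by omega, by simpa using h⟩]
  congr 1
  exact fderiv_apply_congr_of_line hF hG hFG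

lemma Aop_bTrans (hh : 0 < hbar) (u : ℂ) (v : ℝ) {w : (Fin M → ℝ) → ℂ} (hw : ExpBdd w) (n : ℕ) :
    n ≤ M + 1 → ∀ x, Aop (M + 1) hbar u n (bTrans M hbar v w) x
      = bTrans M hbar v (fun y => symX u v (expXY M x y) (expYX M x y) n * w y) x := by
  induction n using Nat.twoStepInduction with
  | zero =>
    intro _ x
    simp [Aop, symX]
  | one =>
    intro _ x
    rw [Aop, pOp_bTrans hh v hw x (by omega), ← bTrans_const_mul, ← bTrans_sub hh v]
    · simp only [symX, zero_add, sub_mul]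
    · exact (ExpBdd.const u).mul hw
    · exact (((ExpBdd.const v).add ((ExpBdd.const _).mul (expBdd_expXY M x _))).sub
        ((ExpBdd.const _).mul (expBdd_expYX M x _))).mul hw
  | more n h1 h2 =>
    intro hn x
    have hW : ExpBdd fun y => symX u v (expXY M x y) (expYX M x y) (n + 1) * w y :=
      (expBdd_symX M x u v (n + 1)).mul hw
    have hW' : ExpBdd fun y => symX u v (expXY M x y) (expYX M x y) n * w y :=
      (expBdd_symX M x u v n).mul hw
    have hsm := contDiff_bTrans hh v hw
    have hp : pOp (M + 1) hbar (Aop (M + 1) hbar u (n + 1) (bTrans M hbar v w)) (n + 2) x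
        = pOp (M + 1) hbar (bTrans M hbar v fun y =>
          symX u v (expXY M x y) (expYX M x y) (n + 1) * w y) (n + 2) x := by
      refine pOp_congr_of_line (n := n + 1) (by omega)
        ((hsm.Aop hbar u (n + 1)).differentiable (by simp) x)
        ((contDiff_bTrans hh v hW).differentiable (by simp) x) fun t => ?_
      rw [h2 (by omega)]
      congr 1
      funext y
      congr 1
      refine symX_congr u v _ (fun k hk => ?_) (fun k hk => ?_)
      · unfold expXY
        rw [xc_add_smul_single _ _ _ (by omega)]
      · unfold expYX
        rw [xc_add_smul_single _ _ _ (by omega)]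
    have hc : ∀ y, (Real.exp (xc (M + 1) x (n + 1) - xc (M + 1) x (n + 2)) : ℂ)
        = expXY M x y (n + 1) * expYX M x y (n + 1) := by
      intro y
      rw [expXY, expYX, if_pos (by omega), if_pos (by omega), ← Complex.ofReal_mul,
        ← Real.exp_add]
      congr 2
      ring
    rw [Aop, hp, pOp_bTrans hh v hW x (by omega), h2 (by omega), h1 (by omega),
      ← bTrans_const_mul, ← bTrans_const_mul, ← bTrans_sub hh v, ← bTrans_sub hh v]
    · congr 1
      funext y
      rw [hc y, symX]
      ring
    · exact ((ExpBdd.const u).mul hW).sub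
        ((((ExpBdd.const v).add ((ExpBdd.const _).mul (expBdd_expXY M x _))).sub
        ((ExpBdd.const _).mul (expBdd_expYX M x _))).mul hW)
    · exact (ExpBdd.const _).mul hW'
    · exact (ExpBdd.const u).mul hW
    · exact (((ExpBdd.const v).add ((ExpBdd.const _).mul (expBdd_expXY M x _))).sub
        ((ExpBdd.const _).mul (expBdd_expYX M x _))).mul hW

end kernelSide

/-- Smooth functions whose partial derivatives of order `≤ m` have at most exponential growth. -/
def ExpSmooth {M : ℕ} : ℕ → ((Fin M → ℝ) → ℂ) → Prop
  | 0, g => ContDiff ℝ (⊤ : ℕ∞) g ∧ ExpBdd g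
  | (m + 1), g => ContDiff ℝ (⊤ : ℕ∞) g ∧ ExpBdd g ∧
      ∀ i : Fin M, ExpSmooth m fun y => fderiv ℝ g y (Pi.single i 1)

namespace ExpSmooth

variable {M : ℕ} {m : ℕ} {g k : (Fin M → ℝ) → ℂ}

lemma contDiff (h : ExpSmooth m g) : ContDiff ℝ (⊤ : ℕ∞) g := by
  cases m <;> exact h.1

lemma differentiable (h : ExpSmooth m g) : Differentiable ℝ g :=
  h.contDiff.differentiable (by simp)

lemma expBdd (h : ExpSmooth m g) : ExpBdd g := by
  cases m
  · exact h.2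
  · exact h.2.1

lemma of_succ (m : ℕ) : ∀ {g : (Fin M → ℝ) → ℂ}, ExpSmooth (m + 1) g → ExpSmooth m g := by
  induction m with
  | zero => exact fun h => ⟨h.1, h.2.1⟩
  | succ m ih => exact fun h => ⟨h.1, h.2.1, fun i => ih (h.2.2 i)⟩

lemma add (m : ℕ) : ∀ {g k : (Fin M → ℝ) → ℂ}, ExpSmooth m g → ExpSmooth m k →
    ExpSmooth m fun y => g y + k y := by
  induction m with
  | zero => exact fun hg hk => ⟨hg.1.add hk.1, hg.2.add hk.2⟩
  | succ m ih =>
    refine fun {g k} hg hk => ⟨hg.1.add hk.1, hg.2.1.add hk.2.1, fun i => ?_⟩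
    convert ih (hg.2.2 i) (hk.2.2 i) using 2 with y
    rw [fderiv_fun_add (hg.differentiable y) (hk.differentiable y)]
    rfl

lemma mul (m : ℕ) : ∀ {g k : (Fin M → ℝ) → ℂ}, ExpSmooth m g → ExpSmooth m k →
    ExpSmooth m fun y => g y * k y := by
  induction m with
  | zero => exact fun hg hk => ⟨hg.1.mul hk.1, hg.2.mul hk.2⟩
  | succ m ih =>
    refine fun {g k} hg hk => ⟨hg.1.mul hk.1, hg.2.1.mul hk.2.1, fun i => ?_⟩
    convert add m (ih (of_succ m hg) (hk.2.2 i)) (ih (of_succ m hk) (hg.2.2 i)) using 2 with y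
    rw [fderiv_fun_mul (hg.differentiable y) (hk.differentiable y)]
    rfl

lemma const (m : ℕ) : ∀ c : ℂ, ExpSmooth m fun _ : Fin M → ℝ => c := by
  induction m with
  | zero => exact fun c => ⟨contDiff_const, ExpBdd.const c⟩
  | succ m ih =>
    refine fun c => ⟨contDiff_const, ExpBdd.const c, fun i => ?_⟩
    simpa using ih 0

lemma sub (hg : ExpSmooth m g) (hk : ExpSmooth m k) : ExpSmooth m fun y => g y - k y := by
  simpa [sub_eq_add_neg] using add m hg (mul m (const m (-1)) hk)

lemma exp_sub (i j : Fin M) (m : ℕ) :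
    ExpSmooth m fun y : Fin M → ℝ => (Real.exp (y i - y j) : ℂ) := by
  have hc : ContDiff ℝ (⊤ : ℕ∞) fun y : Fin M → ℝ => (Real.exp (y i - y j) : ℂ) :=
    Complex.ofRealCLM.contDiff.comp
      (show ContDiff ℝ (⊤ : ℕ∞) fun y : Fin M → ℝ => Real.exp (y i - y j) by fun_prop)
  have hb : ExpBdd fun y : Fin M → ℝ => (Real.exp (y i - y j) : ℂ) := by
    simpa [← Complex.exp_add, sub_eq_add_neg] using
      (ExpBdd.rexp_sub_const i 0).mul (ExpBdd.rexp_const_sub j 0)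
  induction m with
  | zero => exact ⟨hc, hb⟩
  | succ m ih =>
    refine ⟨hc, hb, fun l => ?_⟩
    convert mul m (const m (coordC i (Pi.single l 1) - coordC j (Pi.single l 1))) ih using 2 with y
    have h1 : HasFDerivAt (fun y : Fin M → ℝ => (Real.exp (y i - y j) : ℂ))
        (Complex.exp (coordC i y - coordC j y) • (coordC i - coordC j)) y := by
      have h2 : (fun y : Fin M → ℝ => (Real.exp (y i - y j) : ℂ))
          = fun y => Complex.exp (coordC i y - coordC j y) := by
        funext y
        simp [coordC]
      rw [h2]
      exact ((coordC i).hasFDerivAt.sub (coordC j).hasFDerivAt).cexp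
    rw [h1.fderiv]
    simp [coordC, mul_comm]

lemma pOp (hg : ExpSmooth (m + 1) g) (hbar : ℝ) (n : ℕ) : ExpSmooth m (pOp M hbar g n) := by
  by_cases h : 1 ≤ n ∧ n - 1 < M
  · have : _root_.pOp M hbar g n = fun x =>
        -Complex.I * (hbar : ℂ) * fderiv ℝ g x (Pi.single ⟨n - 1, h.2⟩ 1) := by
      funext x
      exact dif_pos h
    rw [this]
    exact mul m (const m _) (hg.2.2 _)
  · have : _root_.pOp M hbar g n = fun x => 0 := by
      funext x
      exact dif_neg h
    rw [this]
    exact const m 0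

lemma Aop (hbar : ℝ) (u : ℂ) (n : ℕ) : ∀ m, n ≤ M → ExpSmooth (n + m) g →
    ExpSmooth m (Aop M hbar u n g) := by
  induction n using Nat.twoStepInduction with
  | zero =>
    intro m _ hg
    rwa [zero_add] at hg
  | one =>
    intro m _ hg
    rw [add_comm] at hg
    exact (mul m (const m u) (of_succ m hg)).sub (hg.pOp hbar 1)
  | more n h1 h2 =>
    intro m hn hg
    have h3 := h2 (m + 1) (by omega) (by convert hg using 1; ring)
    have h4 := of_succ m (of_succ _ (h1 (m + 2) (by omega) (by convert hg using 1; ring)))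
    refine ((mul m (const m u) (of_succ m h3)).sub (h3.pOp hbar (n + 2))).sub (mul m ?_ h4)
    simp_rw [xc_succ (show n < M by omega), xc_succ (show n + 1 < M by omega)]
    exact exp_sub _ _ m

lemma of_iteratedFDeriv (m : ℕ) : ∀ {g : (Fin M → ℝ) → ℂ} {C : ℝ} (a : ℝ),
    ContDiff ℝ (⊤ : ℕ∞) g → 0 ≤ C →
    (∀ k ≤ m, ∀ y, ‖iteratedFDeriv ℝ k g y‖ ≤ C * Real.exp (a * ∑ i, |y i|)) →
    ExpSmooth m g := by
  induction m with
  | zero =>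
    intro g C a hg hC hb
    exact ⟨hg, hg.continuous, C, a, hC, fun y => by simpa using hb 0 le_rfl y⟩
  | succ m ih =>
    intro g C a hg hC hb
    refine ⟨hg, ⟨hg.continuous, C, a, hC, fun y => by simpa using hb 0 (Nat.zero_le _) y⟩,
      fun i => ?_⟩
    have hfd := (contDiff_infty_iff_fderiv.1 hg).2
    refine ih (C := ‖(Pi.single i 1 : Fin M → ℝ)‖ * C) a (hfd.clm_apply contDiff_const)
      (by positivity) fun k hk y => ?_
    refine (norm_iteratedFDeriv_clm_apply_const (hfd.contDiffAt (x := y))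
      (by exact_mod_cast le_top)).trans ?_
    rw [norm_iteratedFDeriv_fderiv, mul_assoc]
    exact mul_le_mul_of_nonneg_left (hb (k + 1) (by omega) y) (norm_nonneg _)

end ExpSmooth

/-- The logarithmic derivative of `bKer` in the variable `y`. -/
def bKerLogY (M : ℕ) (hbar v : ℝ) (x : Fin (M + 1) → ℝ) (y : Fin M → ℝ) :
    (Fin M → ℝ) →L[ℝ] ℂ :=
  (Complex.I * v / hbar) • (-∑ j, coordC j) - (1 / (hbar : ℂ)) • ∑ i : Fin M,
    ((Real.exp (y i - x i.succ) : ℂ) - (Real.exp (x i.castSucc - y i) : ℂ)) • coordC i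

lemma hasFDerivAt_bKer_right (M : ℕ) (hbar v : ℝ) (x : Fin (M + 1) → ℝ) (y : Fin M → ℝ) :
    HasFDerivAt (bKer M hbar v x) (bKer M hbar v x y • bKerLogY M hbar v x y) y := by
  have hc : ∀ j : Fin M, HasFDerivAt (fun y : Fin M → ℝ => (y j : ℂ)) (coordC j) y :=
    fun j => (coordC j).hasFDerivAt
  have he : ∀ (y : Fin M → ℝ) (i : Fin M),
      ((Real.exp (x i.castSucc - y i) : ℂ) + (Real.exp (y i - x i.succ) : ℂ)) =
      Complex.exp ((x i.castSucc : ℂ) - y i) + Complex.exp ((y i : ℂ) - x i.succ) := by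
    intro y i; push_cast; rfl
  unfold bKer bKerLogY
  refine HasFDerivAt.cexp ?_
  refine HasFDerivAt.sub (((HasFDerivAt.fun_sum fun j _ => hc j).const_sub
      (∑ i, (x i : ℂ))).const_mul (Complex.I * v / hbar)) ?_
  refine HasFDerivAt.const_mul (HasFDerivAt.fun_sum fun i _ => ?_) _
  simp_rw [he]
  have h1 := ((hc i).const_sub (x i.castSucc : ℂ)).cexp
  have h2 := ((hc i).sub_const (x i.succ : ℂ)).cexp
  convert! h1.add h2 using 1
  ext z
  simp
  ring

lemma momentum_bKerLogY {M : ℕ} {hbar : ℝ} (hh : 0 < hbar) (v : ℝ) (x : Fin (M + 1) → ℝ)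
    (y : Fin M → ℝ) {n : ℕ} (h : n < M) :
    Complex.I * hbar * bKerLogY M hbar v x y (Pi.single ⟨n, h⟩ 1)
      = v + Complex.I * expXY M x y (n + 1) - Complex.I * expYX M x y (n + 1) := by
  have hI := Complex.I_mul_I
  have hne : (hbar : ℂ) ≠ 0 := by exact_mod_cast hh.ne'
  have h1 : ∀ c : Fin M → ℂ, ∑ j, c j * coordC j (Pi.single ⟨n, h⟩ 1) = c ⟨n, h⟩ := by
    intro c
    rw [Finset.sum_eq_single ⟨n, h⟩]
    · simp [coordC]
    · intro i _ hi
      simp [coordC, Pi.single_eq_of_ne hi]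
    · simp
  have h2 : ∑ j, coordC j (Pi.single (⟨n, h⟩ : Fin M) (1 : ℝ)) = 1 := by simpa using h1 1
  have h3 : bKerLogY M hbar v x y (Pi.single ⟨n, h⟩ 1) = Complex.I * v / hbar * -1
      - (1 / (hbar : ℂ)) * ((Real.exp (y ⟨n, h⟩ - x (⟨n, h⟩ : Fin M).succ) : ℂ)
        - (Real.exp (x (⟨n, h⟩ : Fin M).castSucc - y ⟨n, h⟩) : ℂ)) := by
    simp only [bKerLogY, sub_apply, smul_apply, neg_apply, sum_apply, smul_eq_mul]
    rw [h2, h1]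
  have hα : expXY M x y (n + 1) = (Real.exp (x (⟨n, h⟩ : Fin M).castSucc - y ⟨n, h⟩) : ℂ) := by
    rw [expXY, if_pos ⟨by omega, h⟩, xc_succ h, xc_succ (by omega)]
    rfl
  have hβ : expYX M x y (n + 1) = (Real.exp (y ⟨n, h⟩ - x (⟨n, h⟩ : Fin M).succ) : ℂ) := by
    rw [expYX, if_pos ⟨by omega, h⟩, xc_succ h, xc_succ (by omega)]
    rfl
  rw [h3, ← hα, ← hβ]
  field_simp
  linear_combination (-(v : ℂ)) * hI

section transpose

variable {M : ℕ} {hbar : ℝ}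

lemma bTrans_mul_pOp (hh : 0 < hbar) (v : ℝ) (x : Fin (M + 1) → ℝ) {n : ℕ} (h : n < M)
    {W k : (Fin M → ℝ) → ℂ} (hW : ExpBdd W)
    (hWn : ∀ (y : Fin M → ℝ) (t : ℝ), W (y + t • Pi.single ⟨n, h⟩ 1) = W y)
    (hk : ExpSmooth 1 k) :
    bTrans M hbar v (fun y => W y * pOp M hbar k (n + 1) y) x
      = bTrans M hbar v (fun y => W y *
        (v + Complex.I * expXY M x y (n + 1) - Complex.I * expYX M x y (n + 1)) * k y) x := by
  have hne : (hbar : ℂ) ≠ 0 := by exact_mod_cast hh.ne'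
  set e : Fin M → ℝ := Pi.single ⟨n, h⟩ 1
  have hLog : ∀ y, bKerLogY M hbar v x y e = (Complex.I * hbar)⁻¹ *
      (v + Complex.I * expXY M x y (n + 1) - Complex.I * expYX M x y (n + 1)) := by
    intro y
    rw [← momentum_bKerLogY hh v x y h, inv_mul_cancel_left₀ (mul_ne_zero Complex.I_ne_zero hne)]
  have hc : ExpBdd fun y =>
      v + Complex.I * expXY M x y (n + 1) - Complex.I * expYX M x y (n + 1) :=
    ((ExpBdd.const v).add ((ExpBdd.const _).mul (expBdd_expXY M x _))).sub
      ((ExpBdd.const _).mul (expBdd_expYX M x _))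
  have hL : ExpBdd fun y => bKerLogY M hbar v x y e := by
    simp_rw [hLog]
    exact (ExpBdd.const _).mul hc
  have hk' : ExpBdd fun y => fderiv ℝ k y e := (hk.2.2 ⟨n, h⟩).expBdd
  have hparts := integral_bilinear_hasLineDerivAt_right_eq_neg_left_of_integrable
    (μ := (volume : Measure (Fin M → ℝ))) (B := ContinuousLinearMap.mul ℝ ℂ)
    (f := fun y => bKer M hbar v x y * W y)
    (f' := fun y => bKer M hbar v x y * bKerLogY M hbar v x y e * W y)
    (g := k) (g' := fun y => fderiv ℝ k y e) (v := e)
    (by simpa [mul_assoc] using integrable_bKer_mul hh v x (hL.mul (hW.mul hk.expBdd)))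
    (by simpa [mul_assoc] using integrable_bKer_mul hh v x (hW.mul hk'))
    (by simpa [mul_assoc] using integrable_bKer_mul hh v x (hW.mul hk.expBdd))
    (fun y _ => by
      have h1 := (hasFDerivAt_bKer_right M hbar v x y).hasLineDerivAt e
      unfold HasLineDerivAt at h1 ⊢
      simp_rw [hWn]
      exact h1.mul_const (W y))
    (fun y _ => (hk.differentiable y).hasFDerivAt.hasLineDerivAt e)
  have hleft : bTrans M hbar v (fun y => W y * pOp M hbar k (n + 1) y) x
      = (-Complex.I * hbar) * ∫ y, bKer M hbar v x y * W y * fderiv ℝ k y e := by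
    unfold bTrans
    rw [← integral_const_mul]
    refine integral_congr_ae (Filter.Eventually.of_forall fun y => ?_)
    have : pOp M hbar k (n + 1) y = -Complex.I * hbar * fderiv ℝ k y e :=
      dif_pos ⟨by omega, by simpa using h⟩
    simp only [this]
    ring
  simp only [ContinuousLinearMap.mul_apply'] at hparts
  rw [hleft, hparts, mul_neg, ← neg_mul, ← integral_const_mul]
  refine integral_congr_ae (Filter.Eventually.of_forall fun y => ?_)
  simp only [hLog]
  field_simp

lemma bTrans_mul_Aop (hh : 0 < hbar) (u : ℂ) (v : ℝ) (x : Fin (M + 1) → ℝ)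
    {f : (Fin M → ℝ) → ℂ} (hf : ∀ m ≤ M, ExpSmooth m f) (n : ℕ) :
    n ≤ M → ∀ W : (Fin M → ℝ) → ℂ, ExpBdd W →
    (∀ (k : ℕ) (hk : k < M), k < n → ∀ (y : Fin M → ℝ) (t : ℝ),
      W (y + t • Pi.single ⟨k, hk⟩ 1) = W y) →
    bTrans M hbar v (fun y => W y * Aop M hbar u n f y) x
      = bTrans M hbar v (fun y => W y * (symY u v (expXY M x y) (expYX M x y) n * f y)) x := by
  induction n using Nat.twoStepInduction with
  | zero =>
    intro _ W _ _
    simp [Aop, symY]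
  | one =>
    intro hn W hW hWn
    have hf1 := hf 1 hn
    have hp : ExpBdd (pOp M hbar f 1) := (ExpSmooth.pOp (m := 0) hf1 hbar 1).expBdd
    have h1 : (fun y => W y * Aop M hbar u 1 f y)
        = fun y => (u * (W y * f y)) - W y * pOp M hbar f 1 y := by
      funext y
      rw [Aop]
      ring
    rw [h1, bTrans_sub hh v ((ExpBdd.const u).mul (hW.mul hf1.expBdd)) (hW.mul hp),
      bTrans_mul_pOp hh v x (by omega) hW (hWn 0 (by omega) one_pos) hf1, ← bTrans_sub hh v]
    · congr 1
      funext y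
      rw [symY]
      ring
    · exact (ExpBdd.const u).mul (hW.mul hf1.expBdd)
    · exact (hW.mul (((ExpBdd.const v).add ((ExpBdd.const _).mul (expBdd_expXY M x _))).sub
        ((ExpBdd.const _).mul (expBdd_expYX M x _)))).mul hf1.expBdd
  | more n h1 h2 =>
    intro hn W hW hWn
    have hA1 : ExpSmooth 1 (Aop M hbar u (n + 1) f) :=
      ExpSmooth.Aop hbar u (n + 1) 1 (by omega) (hf _ (by omega))
    have hA0 : ExpSmooth 0 (Aop M hbar u n f) :=
      ExpSmooth.Aop hbar u n 0 (by omega) (hf _ (by omega))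
    have hp : ExpBdd (pOp M hbar (Aop M hbar u (n + 1) f) (n + 2)) :=
      (ExpSmooth.pOp (m := 0) hA1 hbar (n + 2)).expBdd
    have hm : ExpBdd fun y =>
        v + Complex.I * expXY M x y (n + 2) - Complex.I * expYX M x y (n + 2) :=
      ((ExpBdd.const v).add ((ExpBdd.const _).mul (expBdd_expXY M x _))).sub
        ((ExpBdd.const _).mul (expBdd_expYX M x _))
    have hβα : ExpBdd fun y => expYX M x y (n + 1) * expXY M x y (n + 2) :=
      (expBdd_expYX M x _).mul (expBdd_expXY M x _)
    have he : ∀ y, (Real.exp (xc M y (n + 1) - xc M y (n + 2)) : ℂ)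
        = expYX M x y (n + 1) * expXY M x y (n + 2) := by
      intro y
      rw [expXY, expYX, if_pos (by omega), if_pos (by omega), ← Complex.ofReal_mul,
        ← Real.exp_add]
      congr 2
      ring
    have hsplit : (fun y => W y * Aop M hbar u (n + 2) f y)
        = fun y => (u * (W y * Aop M hbar u (n + 1) f y)
          - W y * pOp M hbar (Aop M hbar u (n + 1) f) (n + 2) y)
          - W y * (expYX M x y (n + 1) * expXY M x y (n + 2)) * Aop M hbar u n f y := by
      funext y
      rw [Aop, he y]
      ring
    have hX : ∀ (k : ℕ) (hk : k < M) (j : ℕ), j ≠ k + 1 → ∀ (y : Fin M → ℝ) (t : ℝ),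
        expXY M x (y + t • Pi.single ⟨k, hk⟩ 1) j = expXY M x y j := by
      intro k hk j hj y t
      unfold expXY
      rw [xc_add_smul_single _ _ _ hj]
    have hY : ∀ (k : ℕ) (hk : k < M) (j : ℕ), j ≠ k + 1 → ∀ (y : Fin M → ℝ) (t : ℝ),
        expYX M x (y + t • Pi.single ⟨k, hk⟩ 1) j = expYX M x y j := by
      intro k hk j hj y t
      unfold expYX
      rw [xc_add_smul_single _ _ _ hj]
    have hu := (ExpBdd.const u).mul (hW.mul hA1.expBdd)
    have hcomb : bTrans M hbar v (fun y => u * (W y * Aop M hbar u (n + 1) f y)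
          - W y * pOp M hbar (Aop M hbar u (n + 1) f) (n + 2) y) x
        = bTrans M hbar v (fun y => (W y * (u - (v + Complex.I * expXY M x y (n + 2)
          - Complex.I * expYX M x y (n + 2)))) * Aop M hbar u (n + 1) f y) x := by
      rw [bTrans_sub hh v hu (hW.mul hp),
        bTrans_mul_pOp hh v x (by omega) hW (hWn (n + 1) (by omega) (by omega)) hA1,
        ← bTrans_sub hh v hu ((hW.mul hm).mul hA1.expBdd)]
      congr 1
      funext y
      ring
    have hf0 := (hf 0 (Nat.zero_le _)).expBdd
    have hWc := hW.mul ((ExpBdd.const u).sub hm)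
    rw [hsplit, bTrans_sub hh v (hu.sub (hW.mul hp)) ((hW.mul hβα).mul hA0.expBdd), hcomb,
      h2 (by omega) _ hWc, h1 (by omega) _ (hW.mul hβα), ← bTrans_sub hh v]
    · congr 1
      funext y
      rw [symY]
      ring
    · exact hWc.mul ((expBdd_symY M x u v (n + 1)).mul hf0)
    · exact (hW.mul hβα).mul ((expBdd_symY M x u v n).mul hf0)
    · intro k hk hkn y t
      rw [hWn k hk (by omega), hX k hk _ (by omega), hY k hk _ (by omega)]
    · intro k hk hkn y t
      rw [hWn k hk (by omega), hX k hk _ (by omega), hY k hk _ (by omega)]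

end transpose

/-- the Baxter `Q`-operator transforms a joint eigenfunction of the
`(N−1)`-particle open Toda chain (smooth, of at most exponential growth together with its
partial derivatives of order `≤ N`) into a smooth joint eigenfunction of the `N`-particle
open Toda chain, with the eigenvalue acquiring the extra factor `(u − λ_N)`. -/
theorem baxter_q_operator_eigenfunction (N : ℕ) (hN : 2 ≤ N) (hbar : ℝ) (hhbar : 0 < hbar)
    (lam : ℕ → ℝ) (f : (Fin (N - 1) → ℝ) → ℂ) (hf : ContDiff ℝ (⊤ : ℕ∞) f)
    (C a : ℝ) (hC : 0 < C) (ha : 0 < a)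
    (hbound : ∀ m : ℕ, m ≤ N → ∀ y : Fin (N - 1) → ℝ,
      ‖iteratedFDeriv ℝ m f y‖ ≤ C * Real.exp (a * ∑ i : Fin (N - 1), |y i|))
    (heig : ∀ (u : ℂ) (y : Fin (N - 1) → ℝ),
      Aop (N - 1) hbar u (N - 1) f y
        = (∏ k ∈ Finset.Icc 1 (N - 1), (u - (lam k : ℂ))) * f y) :
    ContDiff ℝ (⊤ : ℕ∞)
      (fun x : Fin N → ℝ =>
        ∫ y : Fin (N - 1) → ℝ, Qker N hbar ((lam N : ℝ) : ℂ) x y * f y) ∧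
    ∀ (u : ℂ) (x : Fin N → ℝ),
      Aop N hbar u N
          (fun x' => ∫ y : Fin (N - 1) → ℝ, Qker N hbar ((lam N : ℝ) : ℂ) x' y * f y) x
        = (∏ k ∈ Finset.Icc 1 N, (u - (lam k : ℂ))) *
            ∫ y : Fin (N - 1) → ℝ, Qker N hbar ((lam N : ℝ) : ℂ) x y * f y := by
  obtain ⟨m, rfl⟩ : ∃ m, N = m + 2 := ⟨N - 2, by omega⟩
  change (Fin (m + 1) → ℝ) → ℂ at f
  have hfun : (fun x : Fin (m + 2) → ℝ =>
      ∫ y : Fin (m + 2 - 1) → ℝ, Qker (m + 2) hbar ((lam (m + 2) : ℝ) : ℂ) x y * f y)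
      = bTrans (m + 1) hbar (lam (m + 2)) f := by
    funext x
    simp_rw [Qker_eq_bKer]
    rfl
  have hfs : ∀ k ≤ m + 1, ExpSmooth k f := fun k hk =>
    ExpSmooth.of_iteratedFDeriv k a hf hC.le fun j hj y => hbound j (by omega) y
  have hf0 : ExpBdd f := (hfs 0 (Nat.zero_le _)).expBdd
  have hpt := congrFun hfun
  rw [hfun]
  refine ⟨contDiff_bTrans hhbar _ hf0, fun u x => ?_⟩
  rw [hpt x]
  refine (Aop_bTrans (M := m + 1) hhbar u _ hf0 (m + 2) le_rfl x).trans ?_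
  have hα : ∀ y, expXY (m + 1) x y (m + 2) = 0 := fun y => if_neg (by omega)
  have hβ : ∀ y, expYX (m + 1) x y (m + 2) = 0 := fun y => if_neg (by omega)
  have hβ0 : ∀ y, expYX (m + 1) x y 0 = 0 := fun y => if_neg (by omega)
  have h1 : (fun y => symX u (lam (m + 2)) (expXY (m + 1) x y) (expYX (m + 1) x y) (m + 2) * f y)
      = fun y => (u - lam (m + 2)) *
        (1 * (symY u (lam (m + 2)) (expXY (m + 1) x y) (expYX (m + 1) x y) (m + 1) * f y)) := by
    funext y
    rw [symX_succ _ _ (hβ0 y), symY, hα, hβ]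
    ring
  have h2 : (fun y => (1 : ℂ) * Aop (m + 1) hbar u (m + 1) f y)
      = fun y => (∏ k ∈ Finset.Icc 1 (m + 1), (u - (lam k : ℂ))) * f y := by
    funext y
    rw [one_mul]
    exact heig u y
  rw [h1, bTrans_const_mul, ← bTrans_mul_Aop hhbar u _ x hfs (m + 1) le_rfl (fun _ => 1)
    (ExpBdd.const 1) (fun _ _ _ _ _ => rfl), h2, bTrans_const_mul,
    Finset.prod_Icc_succ_top (show 1 ≤ m + 1 + 1 by omega)]
  ring
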